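/- arXiv:math/0008088 — 2 statements merged into one kernel-verified Lean document; each statement's English description precedes it below -/
import Mathlib

section
/- Reversed inequality beyond the hemisphere: let n ≥ 2 and π/2 < θ1 < π. With λ1 > 0 and y1 a first eigenfunction of the m = 0 radial problem on (0,θ1) (y1 strictly positive on (0,θ1), bounded near 0 with (sin θ)^{n−1} y1'(θ) → 0 as θ → 0⁺, solving −y1'' − (n−1) cot θ · y1' = λ1 y1, and y1 → 0 at θ1), and λ2 > 0 with y2 a first eigenfunction of the m = 1 radial problem on (0,θ1) (y2 strictly positive on (0,θ1), solving −y2'' − (n−1) cot θ · y2' + (n−1)(sin θ)^{-2} y2 = λ2 y2, with y2 → 0 at 0 and at θ1), one has (λ2 − n)/λ1 < (n+2)/n. -/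
open Real Set Filter

/-- `y` is a first Dirichlet eigenfunction of the geodesic ball of radius `θ1` in `S^n`
with eigenvalue `lam`: a positive, twice continuously differentiable solution of the
`m = 0` radial equation `-y'' - (n-1) cot θ · y' = λ y` on `(0,θ1)`, bounded near `0`
with `(sin θ)^(n-1) y'(θ) → 0` as `θ → 0⁺`, vanishing at `θ1`. -/
def IsFirstRadialEigenfunction (n : ℕ) (θ1 lam : ℝ) (y : ℝ → ℝ) : Prop :=
  ContDiffOn ℝ 2 y (Ioo 0 θ1) ∧
  (∀ θ ∈ Ioo 0 θ1, 0 < y θ) ∧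
  (∃ M, ∀ᶠ θ in nhdsWithin 0 (Ioi 0), |y θ| ≤ M) ∧
  Tendsto (fun θ => Real.sin θ ^ (n - 1) * deriv y θ) (nhdsWithin 0 (Ioi 0)) (nhds 0) ∧
  (∀ θ ∈ Ioo 0 θ1,
    -(deriv (deriv y) θ) - ((n : ℝ) - 1) * Real.cot θ * deriv y θ = lam * y θ) ∧
  Tendsto y (nhdsWithin θ1 (Iio θ1)) (nhds 0)

/-- `y` is a first eigenfunction of the `m = 1` radial problem on `(0,θ1)` (so `lam` is
the second Dirichlet eigenvalue of the geodesic ball of radius `θ1` in `S^n`): a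
positive, twice continuously differentiable solution of
`-y'' - (n-1) cot θ · y' + (n-1) y / sin²θ = λ y` vanishing at `0` and at `θ1`. -/
def IsSecondRadialEigenfunction (n : ℕ) (θ1 lam : ℝ) (y : ℝ → ℝ) : Prop :=
  ContDiffOn ℝ 2 y (Ioo 0 θ1) ∧
  (∀ θ ∈ Ioo 0 θ1, 0 < y θ) ∧
  (∀ θ ∈ Ioo 0 θ1,
    -(deriv (deriv y) θ) - ((n : ℝ) - 1) * Real.cot θ * deriv y θ
      + ((n : ℝ) - 1) * y θ / Real.sin θ ^ 2 = lam * y θ) ∧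
  Tendsto y (nhdsWithin 0 (Ioi 0)) (nhds 0) ∧
  Tendsto y (nhdsWithin θ1 (Iio θ1)) (nhds 0)

/-- Differentiability facts for a function that is `C^2` on an open interval. -/
theorem hasDerivAt_of_contDiffOn_two {y : ℝ → ℝ} {a b x : ℝ}
    (h : ContDiffOn ℝ 2 y (Ioo a b)) (hx : x ∈ Ioo a b) :
    HasDerivAt y (deriv y x) x ∧ HasDerivAt (deriv y) (deriv (deriv y) x) x := by
  have h' : ContDiffOn ℝ (1 + 1) y (Ioo a b) := by
    rwa [one_add_one_eq_two]
  rw [contDiffOn_succ_iff_deriv_of_isOpen isOpen_Ioo] at h'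
  exact ⟨(h'.1.differentiableAt (isOpen_Ioo.mem_nhds hx)).hasDerivAt,
    ((h'.2.2.differentiableOn one_ne_zero).differentiableAt
      (isOpen_Ioo.mem_nhds hx)).hasDerivAt⟩

theorem monotoneOn_Ioo_of_hasDerivAt_nonneg {f f' : ℝ → ℝ} {a b : ℝ}
    (hf : ∀ x ∈ Ioo a b, HasDerivAt f (f' x) x) (hf' : ∀ x ∈ Ioo a b, 0 ≤ f' x) :
    MonotoneOn f (Ioo a b) := by
  apply monotoneOn_of_deriv_nonneg (convex_Ioo a b)
  · exact fun x hx => (hf x hx).continuousAt.continuousWithinAt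
  · rw [interior_Ioo]
    exact fun x hx => (hf x hx).differentiableAt.differentiableWithinAt
  · rw [interior_Ioo]
    intro x hx
    rw [(hf x hx).deriv]
    exact hf' x hx

theorem strictMonoOn_Ioo_of_hasDerivAt_pos {f f' : ℝ → ℝ} {a b : ℝ}
    (hf : ∀ x ∈ Ioo a b, HasDerivAt f (f' x) x) (hf' : ∀ x ∈ Ioo a b, 0 < f' x) :
    StrictMonoOn f (Ioo a b) := by
  apply strictMonoOn_of_deriv_pos (convex_Ioo a b)
  · exact fun x hx => (hf x hx).continuousAt.continuousWithinAt
  · rw [interior_Ioo]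
    intro x hx
    rw [(hf x hx).deriv]
    exact hf' x hx

theorem le_of_monotoneOn_Ioo_of_tendsto {f : ℝ → ℝ} {a b l : ℝ}
    (hf : MonotoneOn f (Ioo a b)) (hl : Tendsto f (nhdsWithin a (Ioi a)) (nhds l))
    {x : ℝ} (hx : x ∈ Ioo a b) : l ≤ f x := by
  refine le_of_tendsto hl ?_
  filter_upwards [Ioo_mem_nhdsGT hx.1] with z hz
  exact hf ⟨hz.1, hz.2.trans hx.2⟩ hx hz.2.le

theorem lt_of_strictMonoOn_Ioo_of_tendsto {f : ℝ → ℝ} {a b l : ℝ}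
    (hf : StrictMonoOn f (Ioo a b)) (hl : Tendsto f (nhdsWithin a (Ioi a)) (nhds l))
    {x : ℝ} (hx : x ∈ Ioo a b) : l < f x := by
  obtain ⟨z, hz⟩ := exists_between hx.1
  have hz' : z ∈ Ioo a b := ⟨hz.1, hz.2.trans hx.2⟩
  exact (le_of_monotoneOn_Ioo_of_tendsto hf.monotoneOn hl hz').trans_lt (hf hz' hx hz.2)

/-- The divergence form `(sin^k y')' = sin^k (y'' + k cot · y')` of the radial operator. -/
theorem hasDerivAt_sin_pow_mul {f : ℝ → ℝ} {f' x : ℝ} (k : ℕ) (hs : Real.sin x ≠ 0)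
    (hf : HasDerivAt f f' x) :
    HasDerivAt (fun θ => Real.sin θ ^ k * f θ)
      (Real.sin x ^ k * (f' + k * Real.cot x * f x)) x := by
  refine HasDerivAt.congr_deriv (((Real.hasDerivAt_sin x).fun_pow k).fun_mul hf) ?_
  rw [Real.cot_eq_cos_div_sin]
  rcases k with _ | k
  · simp
  · simp only [Nat.add_sub_cancel, pow_succ]
    field_simp
    ring

/-- A positive function on a right neighbourhood of `0` cannot satisfy `x y' ≥ e > 0`. -/
theorem not_eventually_le_mul_deriv {y y' : ℝ → ℝ} {e : ℝ} (he : 0 < e)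
    (hpos : ∀ᶠ x in nhdsWithin 0 (Ioi 0), 0 < y x)
    (hder : ∀ᶠ x in nhdsWithin 0 (Ioi 0), HasDerivAt y (y' x) x) :
    ¬ ∀ᶠ x in nhdsWithin 0 (Ioi 0), e ≤ x * y' x := by
  intro hev
  obtain ⟨r, hr, hball⟩ := mem_nhdsGT_iff_exists_Ioo_subset.1 (hder.and hev)
  have hr0 : (0 : ℝ) < r := hr
  have hmono : MonotoneOn (fun x => y x - e * Real.log x) (Ioo 0 r) := by
    refine monotoneOn_Ioo_of_hasDerivAt_nonneg (f' := fun x => y' x - e * x⁻¹) ?_ ?_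
    · intro x hx
      exact (hball hx).1.sub ((Real.hasDerivAt_log hx.1.ne').const_mul e)
    · intro x hx
      have := (hball hx).2
      have hx0 : 0 < x := hx.1
      have h2 : e * x⁻¹ ≤ y' x := by
        rw [← div_eq_mul_inv, div_le_iff₀ hx0]
        linarith
      simpa using h2
  have hr2 : r / 2 ∈ Ioo 0 r := ⟨by linarith, by linarith⟩
  have hlog := Real.tendsto_log_nhdsGT_zero.eventually
    (eventually_lt_atBot (-(y (r / 2) - e * Real.log (r / 2)) / e))
  obtain ⟨x, ⟨hx1, hx2⟩, hx3⟩ := ((hlog.and hpos).and (Ioo_mem_nhdsGT hr2.1)).exists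
  have h1 := hmono ⟨hx3.1, hx3.2.trans hr2.2⟩ hr2 hx3.2.le
  rw [lt_div_iff₀ he] at hx1
  simp only at h1
  linarith

section FirstEigenfunction

variable {k : ℕ} {θ1 lam : ℝ} {y : ℝ → ℝ}

/-- The weighted derivative of a first radial eigenfunction is negative. -/
theorem IsFirstRadialEigenfunction.sin_pow_mul_deriv_neg
    (h : IsFirstRadialEigenfunction (k + 1) θ1 lam y) (hθ : θ1 < π) (hlam : 0 < lam)
    {x : ℝ} (hx : x ∈ Ioo 0 θ1) : Real.sin x ^ k * deriv y x < 0 := by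
  obtain ⟨hC, hpos, -, hlim, hode, -⟩ := h
  have hmono : StrictMonoOn (fun θ => -(Real.sin θ ^ k * deriv y θ)) (Ioo 0 θ1) := by
    refine strictMonoOn_Ioo_of_hasDerivAt_pos
      (f' := fun x => lam * (Real.sin x ^ k * y x)) ?_ ?_
    · intro x hx
      have hs := Real.sin_pos_of_pos_of_lt_pi hx.1 (hx.2.trans hθ)
      refine HasDerivAt.congr_deriv ((hasDerivAt_sin_pow_mul k hs.ne'
        (hasDerivAt_of_contDiffOn_two hC hx).2).fun_neg) ?_
      have := hode x hx
      push_cast at this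
      linear_combination Real.sin x ^ k * this
    · intro x hx
      have hs := Real.sin_pos_of_pos_of_lt_pi hx.1 (hx.2.trans hθ)
      have := hpos x hx
      positivity
  have := lt_of_strictMonoOn_Ioo_of_tendsto hmono (by simpa using hlim.neg) hx
  simpa using this

/-- The function `sin^k (a sin · y + cos · y')` with `a = λ / (k + 1)` has derivative
`(a - 1) sin · (sin^k y')`. -/
theorem IsFirstRadialEigenfunction.hasDerivAt_comparison
    (h : IsFirstRadialEigenfunction (k + 1) θ1 lam y) (hθ : θ1 < π)
    {a : ℝ} (ha : a * (k + 1) = lam) {x : ℝ} (hx : x ∈ Ioo 0 θ1) :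
    HasDerivAt (fun θ => Real.sin θ ^ k * (a * Real.sin θ * y θ + Real.cos θ * deriv y θ))
      ((a - 1) * Real.sin x * (Real.sin x ^ k * deriv y x)) x := by
  obtain ⟨hC, -, -, -, hode, -⟩ := h
  have hs := Real.sin_pos_of_pos_of_lt_pi hx.1 (hx.2.trans hθ)
  have hd := hasDerivAt_of_contDiffOn_two hC hx
  refine HasDerivAt.congr_deriv (hasDerivAt_sin_pow_mul k hs.ne'
    ((((Real.hasDerivAt_sin x).const_mul a).fun_mul hd.1).fun_add
      ((Real.hasDerivAt_cos x).fun_mul hd.2))) ?_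
  have := hode x hx
  push_cast at this
  have hcot : Real.cot x * Real.sin x = Real.cos x := by
    rw [Real.cot_eq_cos_div_sin]
    field_simp
  linear_combination Real.sin x ^ k * (-Real.cos x * this + Real.cos x * y x * ha
    + k * a * y x * hcot)

theorem IsFirstRadialEigenfunction.tendsto_comparison
    (h : IsFirstRadialEigenfunction (k + 1) θ1 lam y) (a : ℝ) :
    Tendsto (fun θ => Real.sin θ ^ k * (a * Real.sin θ * y θ + Real.cos θ * deriv y θ))
      (nhdsWithin 0 (Ioi 0)) (nhds 0) := by
  obtain ⟨-, -, ⟨M, hM⟩, hlim, -, -⟩ := h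
  have hsin : Tendsto (fun θ => Real.sin θ ^ k * (a * Real.sin θ))
      (nhdsWithin 0 (Ioi 0)) (nhds 0) := by
    have : Continuous fun θ => Real.sin θ ^ k * (a * Real.sin θ) := by fun_prop
    simpa using (this.tendsto 0).mono_left nhdsWithin_le_nhds
  have hcos : Tendsto Real.cos (nhdsWithin 0 (Ioi 0)) (nhds 1) := by
    simpa using (Real.continuous_cos.tendsto 0).mono_left nhdsWithin_le_nhds
  have hy : IsBoundedUnder (· ≤ ·) (nhdsWithin 0 (Ioi 0)) (norm ∘ y) := ⟨M, by simpa using hM⟩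
  have h1 := hsin.zero_mul_isBoundedUnder_le hy
  have h2 := hcos.mul hlim
  have h3 := h1.add h2
  simp only [mul_zero, add_zero] at h3
  refine h3.congr fun θ => ?_
  simp only [Nat.add_sub_cancel]
  ring

/-- Beyond the hemisphere, `a sin · y + cos · y'` (weighted by `sin^k`) is positive on the
whole ball for `a = λ / (k + 1)`. -/
theorem IsFirstRadialEigenfunction.comparison_pos
    (h : IsFirstRadialEigenfunction (k + 1) θ1 lam y) (hθ' : π / 2 < θ1) (hθ : θ1 < π)
    (hlam : 0 < lam) {a : ℝ} (ha : a * (k + 1) = lam) {x : ℝ} (hx : x ∈ Ioo 0 θ1) :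
    0 < Real.sin x ^ k * (a * Real.sin x * y x + Real.cos x * deriv y x) := by
  have ha0 : 0 < a := by
    by_contra! hle
    nlinarith [mul_nonneg (neg_nonneg.2 hle) (by positivity : (0 : ℝ) ≤ k + 1)]
  have ha1 : a < 1 := by
    by_contra! hle
    have hmono : MonotoneOn
        (fun θ => -(Real.sin θ ^ k * (a * Real.sin θ * y θ + Real.cos θ * deriv y θ)))
        (Ioo 0 θ1) := by
      refine monotoneOn_Ioo_of_hasDerivAt_nonneg
        (fun x hx => (h.hasDerivAt_comparison hθ ha hx).fun_neg) fun x hx => ?_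
      have hs := Real.sin_pos_of_pos_of_lt_pi hx.1 (hx.2.trans hθ)
      have hP := h.sin_pow_mul_deriv_neg hθ hlam hx
      have := mul_nonneg (mul_nonneg (sub_nonneg.2 hle) hs.le) (neg_pos.2 hP).le
      linarith
    have hmem : π / 2 ∈ Ioo 0 θ1 := ⟨by positivity, hθ'⟩
    have h0 := le_of_monotoneOn_Ioo_of_tendsto hmono
      (by simpa using (h.tendsto_comparison a).neg) hmem
    have := mul_pos ha0 (h.2.1 _ hmem)
    simp only [Real.sin_pi_div_two, Real.cos_pi_div_two] at h0
    norm_num at h0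
    linarith
  refine lt_of_strictMonoOn_Ioo_of_tendsto (strictMonoOn_Ioo_of_hasDerivAt_pos
    (fun x hx => h.hasDerivAt_comparison hθ ha hx) fun x hx => ?_) (h.tendsto_comparison a) hx
  have hs := Real.sin_pos_of_pos_of_lt_pi hx.1 (hx.2.trans hθ)
  have hP := h.sin_pow_mul_deriv_neg hθ hlam hx
  have := mul_pos (mul_pos (sub_pos.2 ha1) hs) (neg_pos.2 hP)
  linarith

end FirstEigenfunction

/-- The weighted derivative of a second radial eigenfunction is bounded below near the
boundary of the ball. -/
theorem IsSecondRadialEigenfunction.exists_le_sin_pow_mul_deriv {k : ℕ} {θ1 lam : ℝ}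
    {y : ℝ → ℝ} (h : IsSecondRadialEigenfunction (k + 1) θ1 lam y) (hθ0 : 0 < θ1)
    (hθ : θ1 < π) (hlam : 0 < lam) :
    ∃ C, ∀ᶠ x in nhdsWithin θ1 (Iio θ1), C ≤ Real.sin x ^ k * deriv y x := by
  obtain ⟨hC, hpos, hode, -, hlim⟩ := h
  obtain ⟨r, hr, hball⟩ := (mem_nhdsLT_iff_exists_Ioo_subset' hθ0).1
    ((hlim.eventually_le_const one_pos).and (Ioo_mem_nhdsLT hθ0))
  have hrθ : r < θ1 := hr
  have hmono : MonotoneOn (fun θ => Real.sin θ ^ k * deriv y θ + lam * θ) (Ioo r θ1) := by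
    refine monotoneOn_Ioo_of_hasDerivAt_nonneg (f' := fun x =>
      Real.sin x ^ k * (k * y x / Real.sin x ^ 2 - lam * y x) + lam) ?_ ?_
    · intro x hx
      have hx' := (hball hx).2
      have hs := Real.sin_pos_of_pos_of_lt_pi hx'.1 (hx'.2.trans hθ)
      refine HasDerivAt.congr_deriv ((hasDerivAt_sin_pow_mul k hs.ne'
        (hasDerivAt_of_contDiffOn_two hC hx').2).fun_add
          ((hasDerivAt_id x).const_mul lam)) ?_
      have := hode x hx'
      push_cast at this
      linear_combination -Real.sin x ^ k * this
    · intro x hx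
      obtain ⟨hy1, hx'⟩ := hball hx
      have hs := Real.sin_pos_of_pos_of_lt_pi hx'.1 (hx'.2.trans hθ)
      have hy := hpos x hx'
      have h1 : Real.sin x ^ k * y x ≤ 1 :=
        mul_le_one₀ (pow_le_one₀ hs.le (Real.sin_le_one x)) hy.le hy1
      have h2 : 0 ≤ Real.sin x ^ k * (k * y x / Real.sin x ^ 2) := by positivity
      nlinarith
  obtain ⟨z, hz⟩ := exists_between hrθ
  refine ⟨Real.sin z ^ k * deriv y z + lam * z - lam * θ1, ?_⟩
  filter_upwards [Ioo_mem_nhdsLT hz.2] with x hx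
  have h1 := hmono hz ⟨hz.1.trans hx.1, hx.2⟩ hx.1.le
  simp only at h1
  nlinarith [hx.2]

/-- The weighted Wronskian `sin^k ((sin · y₁)' y₂ - sin · y₁ y₂')` and its derivative. -/
theorem hasDerivAt_sin_mul_wronskian {k : ℕ} {θ1 lam1 lam2 : ℝ} {y1 y2 : ℝ → ℝ}
    (h1 : IsFirstRadialEigenfunction (k + 1) θ1 lam1 y1)
    (h2 : IsSecondRadialEigenfunction (k + 1) θ1 lam2 y2) (hθ : θ1 < π)
    {x : ℝ} (hx : x ∈ Ioo 0 θ1) :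
    HasDerivAt (fun θ => Real.sin θ ^ k *
        ((Real.cos θ * y1 θ + Real.sin θ * deriv y1 θ) * y2 θ
          - Real.sin θ * y1 θ * deriv y2 θ))
      (Real.sin x ^ k * y2 x * ((lam2 - lam1 - (k + 1)) * (Real.sin x * y1 x)
        + 2 * (Real.cos x * deriv y1 x))) x := by
  have hs := Real.sin_pos_of_pos_of_lt_pi hx.1 (hx.2.trans hθ)
  have hd1 := hasDerivAt_of_contDiffOn_two h1.1 hx
  have hd2 := hasDerivAt_of_contDiffOn_two h2.1 hx
  have hsin := Real.hasDerivAt_sin x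
  have hcos := Real.hasDerivAt_cos x
  refine HasDerivAt.congr_deriv (hasDerivAt_sin_pow_mul k hs.ne'
    ((((hcos.fun_mul hd1.1).fun_add (hsin.fun_mul hd1.2)).fun_mul hd2.1).fun_sub
      ((hsin.fun_mul hd1.1).fun_mul hd2.2))) ?_
  have e1 := h1.2.2.2.2.1 x hx
  have e2 := h2.2.2.1 x hx
  push_cast at e1 e2
  have hsc : Real.sin x * (1 / Real.sin x ^ 2) - Real.cot x * Real.cos x = Real.sin x := by
    rw [Real.cot_eq_cos_div_sin]
    field_simp
    linear_combination -Real.sin_sq_add_cos_sq x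
  linear_combination Real.sin x ^ k * (Real.sin x * y1 x * e2 - Real.sin x * y2 x * e1
    - k * y1 x * y2 x * hsc)

/-- Reversed inequality beyond the hemisphere: for a geodesic ball of radius
`π/2 < θ1 < π` in `S^n` with first two Dirichlet eigenvalues `λ₁, λ₂`, one has
`(λ₂ - n)/λ₁ < (n+2)/n`. -/
theorem eigenvalue_gap_ratio_lt_beyond_hemisphere (n : ℕ) (hn : 2 ≤ n)
    (θ1 : ℝ) (hθ1 : π / 2 < θ1) (hθ1' : θ1 < π)
    (lam1 lam2 : ℝ) (hlam1 : 0 < lam1) (hlam2 : 0 < lam2)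
    (y1 y2 : ℝ → ℝ)
    (h1 : IsFirstRadialEigenfunction n θ1 lam1 y1)
    (h2 : IsSecondRadialEigenfunction n θ1 lam2 y2) :
    (lam2 - (n : ℝ)) / lam1 < ((n : ℝ) + 2) / n := by
  obtain ⟨k, rfl⟩ : ∃ k, n = k + 1 := ⟨n - 1, by omega⟩
  have hk : (0 : ℝ) < (k : ℝ) + 1 := by positivity
  have hθ0 : 0 < θ1 := by linarith [Real.pi_pos]
  by_contra! hcon
  push_cast at hcon
  set a := lam1 / ((k : ℝ) + 1) with ha_def
  have ha : a * (k + 1) = lam1 := by rw [ha_def]; field_simp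
  have hgap : 2 * a ≤ lam2 - lam1 - (k + 1) := by
    rw [le_div_iff₀ hlam1] at hcon
    have : ((k : ℝ) + 1 + 2) / (k + 1) * lam1 = lam1 + 2 * a := by
      rw [ha_def]
      field_simp
    linarith
  set W : ℝ → ℝ := fun θ => Real.sin θ ^ k *
        ((Real.cos θ * y1 θ + Real.sin θ * deriv y1 θ) * y2 θ
          - Real.sin θ * y1 θ * deriv y2 θ) with hW
  have hWmono : StrictMonoOn W (Ioo 0 θ1) := by
    refine strictMonoOn_Ioo_of_hasDerivAt_pos
      (fun x hx => hasDerivAt_sin_mul_wronskian h1 h2 hθ1' hx) fun x hx => ?_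
    have hs := Real.sin_pos_of_pos_of_lt_pi hx.1 (hx.2.trans hθ1')
    have hy1 := h1.2.1 x hx
    have hy2 := h2.2.1 x hx
    have hc := mul_pos (h1.comparison_pos hθ1 hθ1' hlam1 ha hx) hy2
    have hm : 0 ≤ Real.sin x ^ k * y2 x * (Real.sin x * y1 x) := by positivity
    nlinarith [mul_le_mul_of_nonneg_right hgap hm]
  -- the Wronskian is negative because its upper limit at the boundary is at most zero
  have hWneg : ∀ x ∈ Ioo 0 θ1, W x < 0 := by
    intro x hx
    obtain ⟨C, hC⟩ := h2.exists_le_sin_pow_mul_deriv hθ0 hθ1' hlam2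
    obtain ⟨z, hz⟩ := exists_between hx.2
    have hz' : z ∈ Ioo 0 θ1 := ⟨hx.1.trans hz.1, hz.2⟩
    have hlim : Tendsto (fun θ => -C * (Real.sin θ * y1 θ)) (nhdsWithin θ1 (Iio θ1)) (nhds 0) := by
      have hs : Tendsto Real.sin (nhdsWithin θ1 (Iio θ1)) (nhds (Real.sin θ1)) :=
        (Real.continuous_sin.tendsto θ1).mono_left nhdsWithin_le_nhds
      simpa using (hs.mul h1.2.2.2.2.2).const_mul (-C)
    refine (hWmono hx hz' hz.1).trans_le (ge_of_tendsto hlim ?_)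
    filter_upwards [hC, Ioo_mem_nhdsLT hθ1, Ioo_mem_nhdsLT hz.2] with t ht htπ htz
    have ht' : t ∈ Ioo 0 θ1 := ⟨hz'.1.trans htz.1, htz.2⟩
    have hs := Real.sin_pos_of_pos_of_lt_pi ht'.1 (ht'.2.trans hθ1')
    have hc : Real.cos t ≤ 0 :=
      Real.cos_nonpos_of_pi_div_two_le_of_le htπ.1.le (by linarith [ht'.2, Real.pi_pos])
    have hP := h1.sin_pow_mul_deriv_neg hθ1' hlam1 ht'
    have hy1 := h1.2.1 t ht'
    have hy2 := h2.2.1 t ht'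
    refine (hWmono hz' ht' htz.1).le.trans ?_
    have t1 : 0 ≤ -Real.cos t * (Real.sin t ^ k * y1 t * y2 t) :=
      mul_nonneg (neg_nonneg.2 hc) (by positivity)
    have t2 : 0 ≤ -(Real.sin t ^ k * deriv y1 t) * (Real.sin t * y2 t) :=
      mul_nonneg (neg_pos.2 hP).le (by positivity)
    have t3 := mul_le_mul_of_nonneg_right ht (by positivity : 0 ≤ Real.sin t * y1 t)
    simp only [hW]
    linarith
  have hmem : π / 2 ∈ Ioo 0 θ1 := ⟨by positivity, hθ1⟩
  set δ := -W (π / 2) with hδ_def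
  have hδ : 0 < δ := neg_pos.2 (hWneg _ hmem)
  obtain ⟨M, hM⟩ := h1.2.2.1
  have hsPy : Tendsto (fun θ => Real.sin θ * (Real.sin θ ^ k * deriv y1 θ) * y2 θ)
      (nhdsWithin 0 (Ioi 0)) (nhds 0) := by
    have hs : Tendsto Real.sin (nhdsWithin 0 (Ioi 0)) (nhds 0) := by
      simpa using (Real.continuous_sin.tendsto 0).mono_left nhdsWithin_le_nhds
    simpa using (hs.mul h1.2.2.2.1).mul h2.2.2.2.1
  have hnear : Ioo 0 θ1 ∈ nhdsWithin (0 : ℝ) (Ioi 0) := Ioo_mem_nhdsGT hθ0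
  have hM0 : 0 < M := by
    obtain ⟨t, ht, ht'⟩ := (hM.and hnear).exists
    exact (abs_pos.2 (h1.2.1 t ht').ne').trans_le ht
  refine not_eventually_le_mul_deriv (y := y2) (y' := deriv y2) (e := δ / 2 / M)
    (by positivity) ?_ ?_ ?_
  · filter_upwards [hnear] with x hx using h2.2.1 x hx
  · filter_upwards [hnear] with x hx using (hasDerivAt_of_contDiffOn_two h2.1 hx).1
  filter_upwards [hnear, Ioo_mem_nhdsGT hmem.1, hM,
    hsPy.eventually_const_lt (by linarith : -(δ / 2) < 0)] with x hx hxπ hxM hxP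
  have hs := Real.sin_pos_of_pos_of_lt_pi hx.1 (hx.2.trans hθ1')
  have hc := Real.cos_pos_of_mem_Ioo ⟨by linarith [hx.1, hmem.1], hxπ.2⟩
  have hy1 := h1.2.1 x hx
  have hy2 := h2.2.1 x hx
  have hWx := hWmono hx hmem hxπ.2
  have t1 : 0 < Real.cos x * (Real.sin x ^ k * y1 x * y2 x) := by positivity
  have key : δ / 2 ≤ Real.sin x ^ (k + 1) * y1 x * deriv y2 x := by
    have : W x = Real.cos x * (Real.sin x ^ k * y1 x * y2 x)
        + Real.sin x * (Real.sin x ^ k * deriv y1 x) * y2 x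
        - Real.sin x ^ (k + 1) * y1 x * deriv y2 x := by
      simp only [hW]
      ring
    linarith
  have hd : 0 < deriv y2 x :=
    pos_of_mul_pos_right ((half_pos hδ).trans_le key) (by positivity)
  have hpow : Real.sin x ^ (k + 1) ≤ x := by
    rw [pow_succ]
    have h3 := mul_le_mul_of_nonneg_right (pow_le_one₀ (n := k) hs.le (Real.sin_le_one x)) hs.le
    linarith [Real.sin_le hx.1.le]
  rw [div_le_iff₀ hM0]
  calc δ / 2 ≤ Real.sin x ^ (k + 1) * y1 x * deriv y2 x := key
    _ ≤ x * M * deriv y2 x := by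
      have := hx.1
      have := (le_abs_self (y1 x)).trans hxM
      gcongr
    _ = x * deriv y2 x * M := by ring
end

section
/- Let n ≥ 2 and 0 < θ1 ≤ π/2. Let λ1 > 0 and let y1 be a first eigenfunction of the m = 0 radial problem on (0,θ1): y1 twice continuously differentiable and strictly positive on (0,θ1), bounded near 0 with (sin θ)^{n−1} y1'(θ) → 0 as θ → 0⁺, solving −y1'' − (n−1) cot θ · y1' = λ1 y1, with y1(θ) → 0 as θ → θ1⁻. Define p(θ) := −y1'(θ)/y1(θ) on (0,θ1). Then p is strictly positive, strictly increasing, and strictly convex on (0,θ1); moreover p(θ) → 0 as θ → 0⁺ and p(θ) → +∞ as θ → θ1⁻. -/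
open Real Set Filter

/-- A function with positive derivative on `(0, b)` and limit `0` at `0⁺` is positive. -/
theorem pos_of_hasDerivAt_pos_of_tendsto_zero {F F' : ℝ → ℝ} {b : ℝ}
    (hF : ∀ x ∈ Ioo 0 b, HasDerivAt F (F' x) x) (hF' : ∀ x ∈ Ioo 0 b, 0 < F' x)
    (h0 : Tendsto F (nhdsWithin 0 (Ioi 0)) (nhds 0)) : ∀ x ∈ Ioo 0 b, 0 < F x := by
  have hmono : StrictMonoOn F (Ioo 0 b) := by
    refine strictMonoOn_of_deriv_pos (convex_Ioo 0 b)
      (fun x hx => (hF x hx).continuousAt.continuousWithinAt) fun x hx => ?_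
    rw [interior_Ioo] at hx
    rw [(hF x hx).deriv]
    exact hF' x hx
  intro x hx
  have hx2 : x / 2 ∈ Ioo 0 b := ⟨by linarith [hx.1], by linarith [hx.1, hx.2]⟩
  have hle : 0 ≤ F (x / 2) := by
    refine le_of_tendsto h0 ?_
    filter_upwards [Ioo_mem_nhdsGT hx2.1] with t ht
    exact (hmono ⟨ht.1, ht.2.trans hx2.2⟩ hx2 ht.2).le
  exact hle.trans_lt (hmono hx2 hx (by linarith [hx.1]))

theorem hasDerivAt_cot {x : ℝ} (hx : sin x ≠ 0) : HasDerivAt cot (-(1 + cot x ^ 2)) x := by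
  have h : HasDerivAt (fun t => cos t / sin t) (-(1 + cot x ^ 2)) x := by
    refine ((hasDerivAt_cos x).div (hasDerivAt_sin x) hx).congr_deriv ?_
    rw [cot_eq_cos_div_sin]
    field_simp
    ring
  exact h.congr_of_eventuallyEq (Eventually.of_forall cot_eq_cos_div_sin)

/-- Let `y > 0` be bounded near `0` and let `p = -y'/y`. If `f' > (2p - (k+2) cot) f` on `(0, b)`
and `sin ^ (k+2) * f → 0` at `0⁺`, then `f > 0`. -/
theorem pos_of_riccati_linearization {k : ℕ} {b : ℝ} {y p f f' : ℝ → ℝ}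
    (hsin : ∀ x ∈ Ioo 0 b, 0 < sin x) (hypos : ∀ x ∈ Ioo 0 b, 0 < y x)
    (hy : ∀ x ∈ Ioo 0 b, HasDerivAt y (-(p x * y x)) x)
    (hybdd : ∃ M, ∀ᶠ x in nhdsWithin 0 (Ioi 0), |y x| ≤ M)
    (hf : ∀ x ∈ Ioo 0 b, HasDerivAt f (f' x) x)
    (hf' : ∀ x ∈ Ioo 0 b, (2 * p x - ((k : ℝ) + 2) * cot x) * f x < f' x)
    (h0 : Tendsto (fun x => sin x ^ (k + 2) * f x) (nhdsWithin 0 (Ioi 0)) (nhds 0)) :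
    ∀ x ∈ Ioo 0 b, 0 < f x := by
  have key : ∀ x ∈ Ioo 0 b, 0 < sin x ^ (k + 2) * f x * y x ^ 2 := by
    refine pos_of_hasDerivAt_pos_of_tendsto_zero
      (F' := fun x => sin x ^ (k + 2) * y x ^ 2 *
        (f' x - (2 * p x - ((k : ℝ) + 2) * cot x) * f x)) ?_ ?_ ?_
    · intro x hx
      have hs := (hsin x hx).ne'
      refine ((((hasDerivAt_sin x).pow (k + 2)).mul (hf x hx)).mul
        ((hy x hx).pow 2)).congr_deriv ?_
      simp only [Pi.pow_apply, Pi.mul_apply]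
      rw [cot_eq_cos_div_sin]
      push_cast
      field_simp
      ring
    · intro x hx
      have := hsin x hx
      have := hypos x hx
      have := sub_pos.2 (hf' x hx)
      positivity
    · obtain ⟨M, hM⟩ := hybdd
      refine h0.zero_mul_isBoundedUnder_le ⟨M ^ 2, ?_⟩
      rw [eventually_map]
      filter_upwards [hM] with x hx
      simpa using pow_le_pow_left₀ (abs_nonneg _) hx 2
  intro x hx
  have h1 := key x hx
  have h2 : 0 < sin x ^ (k + 2) := pow_pos (hsin x hx) _
  have h3 : 0 < y x ^ 2 := pow_pos (hypos x hx) _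
  exact (mul_pos_iff_of_pos_left h2).1 ((mul_pos_iff_of_pos_right h3).1 h1)

/-- For a first Dirichlet eigenfunction `y1` of a geodesic ball of radius
`0 < θ1 ≤ π/2` in `S^n`, the function `p = -y1'/y1` is strictly positive, strictly
increasing, and strictly convex on `(0,θ1)`, with `p → 0` at `0⁺` and `p → ∞`
at `θ1⁻`. -/
theorem log_derivative_properties (n : ℕ) (hn : 2 ≤ n)
    (θ1 : ℝ) (hθ1 : 0 < θ1) (hθ1' : θ1 ≤ π / 2)
    (lam1 : ℝ) (hlam1 : 0 < lam1) (y1 : ℝ → ℝ)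
    (hy1 : ContDiffOn ℝ 2 y1 (Ioo 0 θ1))
    (hy1pos : ∀ θ ∈ Ioo 0 θ1, 0 < y1 θ)
    (hy1bdd : ∃ M, ∀ᶠ θ in nhdsWithin 0 (Ioi 0), |y1 θ| ≤ M)
    (hy1d0 : Tendsto (fun θ => Real.sin θ ^ (n - 1) * deriv y1 θ)
      (nhdsWithin 0 (Ioi 0)) (nhds 0))
    (hode : ∀ θ ∈ Ioo 0 θ1,
      -(deriv (deriv y1) θ) - ((n : ℝ) - 1) * Real.cot θ * deriv y1 θ = lam1 * y1 θ)
    (hy1θ1 : Tendsto y1 (nhdsWithin θ1 (Iio θ1)) (nhds 0))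
    (p : ℝ → ℝ) (hp : ∀ θ, p θ = -(deriv y1 θ) / y1 θ) :
    (∀ θ ∈ Ioo 0 θ1, 0 < p θ) ∧
    StrictMonoOn p (Ioo 0 θ1) ∧
    StrictConvexOn ℝ (Ioo 0 θ1) p ∧
    Tendsto p (nhdsWithin 0 (Ioi 0)) (nhds 0) ∧
    Tendsto p (nhdsWithin θ1 (Iio θ1)) atTop := by
  obtain ⟨k, rfl⟩ : ∃ k, n = k + 2 := ⟨n - 2, by omega⟩
  simp only [show k + 2 - 1 = k + 1 from rfl] at hy1d0
  push_cast at hode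
  have hsin : ∀ x ∈ Ioo 0 θ1, 0 < sin x := fun x hx =>
    sin_pos_of_pos_of_lt_pi hx.1 (by linarith [hx.2, pi_pos])
  have hcos : ∀ x ∈ Ioo 0 θ1, 0 < cos x := fun x hx =>
    cos_pos_of_mem_Ioo ⟨by linarith [hx.1, pi_pos], by linarith [hx.2]⟩
  have hcot : ∀ x ∈ Ioo 0 θ1, 0 < cot x := fun x hx => by
    rw [cot_eq_cos_div_sin]
    exact div_pos (hcos x hx) (hsin x hx)
  have hdy : ∀ x ∈ Ioo 0 θ1, HasDerivAt y1 (deriv y1 x) x := fun x hx =>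
    ((hy1.differentiableOn (by norm_num)).differentiableAt (isOpen_Ioo.mem_nhds hx)).hasDerivAt
  have hddy : ∀ x ∈ Ioo 0 θ1,
      HasDerivAt (deriv y1) (-(lam1 * y1 x) - ((k : ℝ) + 1) * cot x * deriv y1 x) x := by
    intro x hx
    have h1 : ContDiffOn ℝ 1 (deriv y1) (Ioo 0 θ1) :=
      hy1.deriv_of_isOpen isOpen_Ioo (by norm_num)
    have h2 := ((h1.differentiableOn (by norm_num)).differentiableAt
      (isOpen_Ioo.mem_nhds hx)).hasDerivAt
    refine h2.congr_deriv ?_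
    linear_combination -(hode x hx)
  have hdw : ∀ x ∈ Ioo 0 θ1, HasDerivAt (fun t => sin t ^ (k + 1) * deriv y1 t)
      (-(lam1 * sin x ^ (k + 1) * y1 x)) x := by
    intro x hx
    have hs := (hsin x hx).ne'
    refine (((hasDerivAt_sin x).pow (k + 1)).mul (hddy x hx)).congr_deriv ?_
    simp only [Pi.pow_apply]
    rw [cot_eq_cos_div_sin]
    push_cast
    field_simp
    ring
  have hdneg : ∀ x ∈ Ioo 0 θ1, deriv y1 x < 0 := by
    intro x hx
    have h := pos_of_hasDerivAt_pos_of_tendsto_zero (fun x hx => (hdw x hx).neg)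
      (fun x hx => by
        have := hsin x hx
        have := hy1pos x hx
        rw [neg_neg]
        positivity) (by
        have h := hy1d0.neg
        rw [neg_zero] at h
        exact h) x hx
    have h2 : 0 < sin x ^ (k + 1) := pow_pos (hsin x hx) _
    simp only [Pi.neg_apply] at h
    nlinarith
  have hppos : ∀ x ∈ Ioo 0 θ1, 0 < p x := fun x hx => by
    rw [hp]
    exact div_pos (neg_pos.2 (hdneg x hx)) (hy1pos x hx)
  have hyanti : StrictAntiOn y1 (Ioo 0 θ1) := by
    refine strictAntiOn_of_deriv_neg (convex_Ioo 0 θ1)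
      (fun x hx => (hdy x hx).continuousAt.continuousWithinAt) fun x hx => ?_
    rw [interior_Ioo] at hx
    exact hdneg x hx
  have hp0 : Tendsto p (nhdsWithin 0 (Ioi 0)) (nhds 0) := by
    obtain ⟨M, hM⟩ := hy1bdd
    obtain ⟨ε, hε, hεM⟩ := mem_nhdsGT_iff_exists_Ioo_subset.1 hM
    have hε : 0 < ε := hε
    set b := min ε (θ1 / 2) with hb
    have hbpos : 0 < b := lt_min hε (by linarith)
    have hbθ : b < θ1 := (min_le_right _ _).trans_lt (by linarith)
    have hbε : b ≤ ε := min_le_left _ _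
    have hbmem : b ∈ Ioo 0 θ1 := ⟨hbpos, hbθ⟩
    have hsub : ∀ x ∈ Ioo 0 b, x ∈ Ioo 0 θ1 := fun x hx => ⟨hx.1, hx.2.trans hbθ⟩
    have hyb := hy1pos b hbmem
    set C := lam1 * M + 1 with hC
    have hlower : ∀ x ∈ Ioo 0 b, 0 < sin x ^ (k + 1) * deriv y1 x + C * (x * sin x ^ (k + 1)) := by
      refine pos_of_hasDerivAt_pos_of_tendsto_zero
        (F' := fun x => -(lam1 * sin x ^ (k + 1) * y1 x) +
          C * (1 * sin x ^ (k + 1) + x * (((k + 1 : ℕ) : ℝ) * sin x ^ k * cos x))) ?_ ?_ ?_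
      · intro x hx
        exact (hdw x (hsub x hx)).add
          (((hasDerivAt_id x).mul ((hasDerivAt_sin x).pow (k + 1))).const_mul C)
      · intro x hx
        have h1 := hsin x (hsub x hx)
        have h2 := hcos x (hsub x hx)
        have h3 := hx.1
        have h4 : |y1 x| ≤ M := hεM ⟨hx.1, hx.2.trans_le hbε⟩
        have h5 : y1 x ≤ M := (le_abs_self _).trans h4
        have h6 : 0 ≤ M := (abs_nonneg _).trans h4
        have h7 : 0 < C := by positivity
        have h8 : 0 ≤ C * (x * (((k + 1 : ℕ) : ℝ) * sin x ^ k * cos x)) := by positivity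
        have h9 : 0 < sin x ^ (k + 1) * (C - lam1 * y1 x) := by
          refine mul_pos (by positivity) ?_
          have := mul_le_mul_of_nonneg_left h5 hlam1.le
          rw [hC]
          linarith
        linarith
      · have hc : Tendsto (fun x : ℝ => C * (x * sin x ^ (k + 1))) (nhdsWithin 0 (Ioi 0))
            (nhds 0) := by
          have : Continuous fun x : ℝ => C * (x * sin x ^ (k + 1)) := by fun_prop
          simpa using (this.tendsto 0).mono_left nhdsWithin_le_nhds
        simpa using hy1d0.add hc
    have hupper : ∀ x ∈ Ioo 0 b, p x ≤ C * x / y1 b := by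
      intro x hx
      have h1 : 0 < sin x ^ (k + 1) := pow_pos (hsin x (hsub x hx)) _
      have h2 := hlower x hx
      have h3 : 0 < deriv y1 x + C * x := by
        refine (mul_pos_iff_of_pos_left h1).1 ?_
        linarith
      have h4 := hyanti (hsub x hx) hbmem hx.2
      have h5 := hdneg x (hsub x hx)
      rw [hp]
      exact div_le_div₀ (by linarith) (by linarith) hyb h4.le
    have hlim : Tendsto (fun x : ℝ => C * x / y1 b) (nhdsWithin 0 (Ioi 0)) (nhds 0) := by
      have : Continuous fun x : ℝ => C * x / y1 b := by fun_prop
      simpa using (this.tendsto 0).mono_left nhdsWithin_le_nhds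
    refine tendsto_of_tendsto_of_tendsto_of_le_of_le' tendsto_const_nhds hlim ?_ ?_
    · filter_upwards [Ioo_mem_nhdsGT hθ1] with x hx using (hppos x hx).le
    · filter_upwards [Ioo_mem_nhdsGT hbpos] with x hx using hupper x hx
  have hdyp : ∀ x ∈ Ioo 0 θ1, HasDerivAt y1 (-(p x * y1 x)) x := by
    intro x hx
    have hy := (hy1pos x hx).ne'
    refine (hdy x hx).congr_deriv ?_
    rw [hp]
    field_simp
  set q : ℝ → ℝ := fun x => lam1 + p x ^ 2 - ((k : ℝ) + 1) * (cot x * p x) with hq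
  set s : ℝ → ℝ := fun x => lam1 + p x ^ 2 - ((k : ℝ) + 2) * (cot x * p x) with hs
  set r : ℝ → ℝ := fun x => 2 * (p x * q x) + ((k : ℝ) + 1) * (p x - cot x * s x) with hr
  have hpq : ∀ x ∈ Ioo 0 θ1, HasDerivAt p (q x) x := by
    intro x hx
    have hy := (hy1pos x hx).ne'
    have h : HasDerivAt (fun t => -(deriv y1 t) / y1 t) (q x) x := by
      refine ((hddy x hx).neg.div (hdy x hx) hy).congr_deriv ?_
      simp only [hq, hp, Pi.neg_apply]
      field_simp
      ring
    exact h.congr_of_eventuallyEq (Eventually.of_forall hp)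
  have hdcot : ∀ x ∈ Ioo 0 θ1, HasDerivAt cot (-(1 + cot x ^ 2)) x := fun x hx =>
    hasDerivAt_cot (hsin x hx).ne'
  have hdq : ∀ x ∈ Ioo 0 θ1, HasDerivAt q (r x) x := by
    intro x hx
    refine ((((hpq x hx).pow 2).const_add lam1).sub
      (((hdcot x hx).mul (hpq x hx)).const_mul ((k : ℝ) + 1))).congr_deriv ?_
    simp only [hr, hs, hq]
    push_cast
    ring
  have hds : ∀ x ∈ Ioo 0 θ1, HasDerivAt s
      ((2 * p x - ((k : ℝ) + 2) * cot x) * s x + (2 * (p x ^ 2 * cot x) + ((k : ℝ) + 2) * p x))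
      x := by
    intro x hx
    refine ((((hpq x hx).pow 2).const_add lam1).sub
      (((hdcot x hx).mul (hpq x hx)).const_mul ((k : ℝ) + 2))).congr_deriv ?_
    simp only [hs, hq]
    push_cast
    ring
  have hdr : ∀ x ∈ Ioo 0 θ1, HasDerivAt r
      ((2 * p x - ((k : ℝ) + 2) * cot x) * r x + (2 * (p x * q x * cot x) +
        ((k : ℝ) + 1) * (p x * cot x) + 2 * q x ^ 2 +
        ((k : ℝ) + 1) * ((2 + cot x ^ 2) * s x))) x := by
    intro x hx
    refine ((((hpq x hx).mul (hdq x hx)).const_mul 2).add (((hpq x hx).sub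
      ((hdcot x hx).mul (hds x hx))).const_mul ((k : ℝ) + 1))).congr_deriv ?_
    simp only [hr, hs, hq]
    ring
  have hsin0 : Tendsto sin (nhdsWithin 0 (Ioi 0)) (nhds 0) := by
    simpa using (continuous_sin.tendsto 0).mono_left nhdsWithin_le_nhds
  have hcos0 : Tendsto cos (nhdsWithin 0 (Ioi 0)) (nhds 1) := by
    simpa using (continuous_cos.tendsto 0).mono_left nhdsWithin_le_nhds
  have htriple : Tendsto (fun x => (sin x, cos x, p x)) (nhdsWithin 0 (Ioi 0))
      (nhds (0, 1, 0)) := hsin0.prodMk_nhds (hcos0.prodMk_nhds hp0)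
  have hspos : ∀ x ∈ Ioo 0 θ1, 0 < s x := by
    refine pos_of_riccati_linearization (k := k) hsin hy1pos hdyp hy1bdd hds (fun x hx => ?_) ?_
    · have := hppos x hx
      have := hcot x hx
      exact lt_add_of_pos_right _ (by positivity)
    · have hg : Continuous fun z : ℝ × ℝ × ℝ => lam1 * z.1 ^ (k + 2) + z.2.2 ^ 2 * z.1 ^ (k + 2)
          - ((k : ℝ) + 2) * (z.1 ^ (k + 1) * z.2.1 * z.2.2) := by fun_prop
      have h := (hg.tendsto (0, 1, 0)).comp htriple
      simp only [ne_eq, Nat.add_eq_zero_iff, OfNat.ofNat_ne_zero, one_ne_zero, and_false,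
        not_false_eq_true, zero_pow, mul_zero, add_zero, sub_zero] at h
      refine h.congr' ?_
      filter_upwards [Ioo_mem_nhdsGT hθ1] with x hx
      have hs0 := (hsin x hx).ne'
      simp only [Function.comp_apply, hs]
      rw [cot_eq_cos_div_sin]
      field_simp
      ring
  have hqpos : ∀ x ∈ Ioo 0 θ1, 0 < q x := by
    intro x hx
    have h1 : q x = s x + cot x * p x := by
      simp only [hq, hs]
      ring
    rw [h1]
    exact add_pos (hspos x hx) (mul_pos (hcot x hx) (hppos x hx))
  have hrpos : ∀ x ∈ Ioo 0 θ1, 0 < r x := by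
    refine pos_of_riccati_linearization (k := k) hsin hy1pos hdyp hy1bdd hdr (fun x hx => ?_) ?_
    · have := hppos x hx
      have := hcot x hx
      have := hqpos x hx
      have := hspos x hx
      exact lt_add_of_pos_right _ (by positivity)
    · have hg : Continuous fun z : ℝ × ℝ × ℝ =>
          2 * z.2.2 * (lam1 * z.1 ^ (k + 2) + z.2.2 ^ 2 * z.1 ^ (k + 2)
            - ((k : ℝ) + 1) * (z.1 ^ (k + 1) * z.2.1 * z.2.2))
          + ((k : ℝ) + 1) * (z.2.2 * z.1 ^ (k + 2) - (lam1 * z.1 ^ (k + 1) * z.2.1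
            + z.2.2 ^ 2 * z.1 ^ (k + 1) * z.2.1
            - ((k : ℝ) + 2) * (z.1 ^ k * z.2.1 ^ 2 * z.2.2))) := by fun_prop
      have h := (hg.tendsto (0, 1, 0)).comp htriple
      simp only [ne_eq, Nat.add_eq_zero_iff, OfNat.ofNat_ne_zero, one_ne_zero, and_false,
        not_false_eq_true, zero_pow, mul_zero, zero_mul, add_zero, sub_zero] at h
      refine h.congr' ?_
      filter_upwards [Ioo_mem_nhdsGT hθ1] with x hx
      have hs0 := (hsin x hx).ne'
      simp only [Function.comp_apply, hr, hs, hq]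
      rw [cot_eq_cos_div_sin]
      field_simp
      ring
  have hpcont : ContinuousOn p (Ioo 0 θ1) := fun x hx =>
    (hpq x hx).continuousAt.continuousWithinAt
  have hpmono : StrictMonoOn p (Ioo 0 θ1) := by
    refine strictMonoOn_of_deriv_pos (convex_Ioo 0 θ1) hpcont fun x hx => ?_
    rw [interior_Ioo] at hx
    rw [(hpq x hx).deriv]
    exact hqpos x hx
  have hqmono : StrictMonoOn q (Ioo 0 θ1) := by
    refine strictMonoOn_of_deriv_pos (convex_Ioo 0 θ1)
      (fun x hx => (hdq x hx).continuousAt.continuousWithinAt) fun x hx => ?_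
    rw [interior_Ioo] at hx
    rw [(hdq x hx).deriv]
    exact hrpos x hx
  refine ⟨hppos, hpmono, ?_, hp0, ?_⟩
  · refine StrictMonoOn.strictConvexOn_of_deriv (convex_Ioo 0 θ1) hpcont ?_
    rw [interior_Ioo]
    exact hqmono.congr fun x hx => (hpq x hx).deriv.symm
  · refine tendsto_atTop.2 fun B => ?_
    by_cases hB : ∃ x ∈ Ioo 0 θ1, B ≤ p x
    · obtain ⟨x, hx, hxB⟩ := hB
      filter_upwards [Ioo_mem_nhdsLT hx.2] with t ht
      exact hxB.trans (hpmono hx ⟨hx.1.trans ht.1, ht.2⟩ ht.1).le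
    · push Not at hB
      have hd : ∀ x ∈ Ioo 0 θ1, HasDerivAt (fun t => y1 t * exp (B * t))
          ((B - p x) * (y1 x * exp (B * x))) x := by
        intro x hx
        refine ((hdyp x hx).mul (((hasDerivAt_id x).const_mul B).exp)).congr_deriv ?_
        simp only [id]
        ring
      have hmono : StrictMonoOn (fun t => y1 t * exp (B * t)) (Ioo 0 θ1) := by
        refine strictMonoOn_of_deriv_pos (convex_Ioo 0 θ1)
          (fun x hx => (hd x hx).continuousAt.continuousWithinAt) fun x hx => ?_
        rw [interior_Ioo] at hx
        rw [(hd x hx).deriv]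
        exact mul_pos (sub_pos.2 (hB x hx)) (mul_pos (hy1pos x hx) (exp_pos _))
      have hexp : Tendsto (fun t => exp (B * t)) (nhdsWithin θ1 (Iio θ1))
          (nhds (exp (B * θ1))) := by
        have : Continuous fun t => exp (B * t) := by fun_prop
        exact (this.tendsto θ1).mono_left nhdsWithin_le_nhds
      have hlim := hy1θ1.mul hexp
      rw [zero_mul] at hlim
      have hmid : θ1 / 2 ∈ Ioo 0 θ1 := ⟨by linarith, by linarith⟩
      have hle : y1 (θ1 / 2) * exp (B * (θ1 / 2)) ≤ 0 := by
        refine ge_of_tendsto hlim ?_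
        filter_upwards [Ioo_mem_nhdsLT hmid.2] with t ht
        exact (hmono hmid ⟨hmid.1.trans ht.1, ht.2⟩ ht.1).le
      exact absurd hle (not_le.2 (mul_pos (hy1pos _ hmid) (exp_pos _)))
end
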